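/- Fix n ∈ ℕ with n ≥ 2 and work in the free commutative monoid ℕ^n of functions Fin n → ℕ with pointwise addition. For a permutation σ of Fin n and 0 ≤ k ≤ n let A_σ(k) ∈ ℕ^n be the indicator function of the set σ({0,…,k−1}), let A_σ := {A_σ(k) : 0 ≤ k ≤ n}, let rev denote the permutation i ↦ n−1−i of Fin n, and let S_σ := A_σ ∪ A_{σ∘rev}. Then: (a) A_σ ≠ A_{σ∘rev}; and (b) for permutations σ, τ of Fin n, S_τ = S_σ holds if and only if τ = σ or τ = σ∘rev. In particular, exactly two alignments give rise to any given semi-alignment. -/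

import Mathlib

/-- The indicator vector in `ℕ^n` of the set `σ({0,…,k-1})`. -/
def alignVec {n : ℕ} (σ : Equiv.Perm (Fin n)) (k : ℕ) : Fin n → ℕ :=
  fun i => if (σ.symm i : ℕ) < k then 1 else 0

/-- The alignment associated to a permutation `σ`. -/
def alignSet {n : ℕ} (σ : Equiv.Perm (Fin n)) : Set (Fin n → ℕ) :=
  {a | ∃ k ≤ n, a = alignVec σ k}

/-- The semi-alignment associated to `σ`. -/
def semiAlignSet {n : ℕ} (σ : Equiv.Perm (Fin n)) : Set (Fin n → ℕ) :=
  alignSet σ ∪ alignSet (σ * Fin.revPerm)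

theorem sum_alignVec {n : ℕ} (σ : Equiv.Perm (Fin n)) {k : ℕ} (hk : k ≤ n) :
    ∑ i, alignVec σ k i = k := by
  unfold alignVec
  rw [Equiv.sum_comp σ.symm (fun i : Fin n => if (i : ℕ) < k then 1 else 0)]
  simp [Fin.card_filter_val_lt, hk]

theorem eq_of_alignVec_eq {n : ℕ} {σ τ : Equiv.Perm (Fin n)} {j k : ℕ} (hj : j ≤ n) (hk : k ≤ n)
    (h : alignVec τ k = alignVec σ j) : k = j := by
  rw [← sum_alignVec τ hk, h, sum_alignVec σ hj]

theorem alignVec_eq_iff {n : ℕ} {σ τ : Equiv.Perm (Fin n)} {j k : ℕ} :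
    alignVec τ k = alignVec σ j ↔ ∀ i, (τ.symm i : ℕ) < k ↔ (σ.symm i : ℕ) < j := by
  unfold alignVec
  rw [funext_iff]
  refine forall_congr' fun i => ?_
  split_ifs <;> grind

theorem perm_eq_of_alignVec_eq {n : ℕ} {σ τ : Equiv.Perm (Fin n)}
    (h : ∀ k ≤ n, alignVec τ k = alignVec σ k) : τ = σ := by
  have hsymm : τ.symm = σ.symm := by
    ext i
    have h₁ := alignVec_eq_iff.1 (h (τ.symm i) (τ.symm i).isLt.le) i
    have h₂ := alignVec_eq_iff.1 (h (σ.symm i) (σ.symm i).isLt.le) i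
    omega
  simpa using congrArg Equiv.symm hsymm

theorem alignSet_injective {n : ℕ} : Function.Injective (alignSet (n := n)) := by
  intro τ σ h
  refine perm_eq_of_alignVec_eq fun k hk => ?_
  have hmem : alignVec τ k ∈ alignSet σ := h ▸ ⟨k, hk, rfl⟩
  obtain ⟨j, hj, hjk⟩ := hmem
  rw [hjk, eq_of_alignVec_eq hj hk hjk]

theorem mul_revPerm_mul_revPerm {n : ℕ} (σ : Equiv.Perm (Fin n)) :
    σ * Fin.revPerm * Fin.revPerm = σ := by
  ext i
  simp

theorem semiAlignSet_mul_revPerm {n : ℕ} (σ : Equiv.Perm (Fin n)) :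
    semiAlignSet (σ * Fin.revPerm) = semiAlignSet σ := by
  rw [semiAlignSet, semiAlignSet, mul_revPerm_mul_revPerm, Set.union_comm]

theorem alignVec_mem_semiAlignSet {n : ℕ} {σ τ : Equiv.Perm (Fin n)} {k : ℕ} (hk : k ≤ n)
    (h : semiAlignSet τ = semiAlignSet σ) :
    alignVec τ k = alignVec σ k ∨ alignVec τ k = alignVec (σ * Fin.revPerm) k := by
  have hmem : alignVec τ k ∈ semiAlignSet σ := h ▸ Or.inl ⟨k, hk, rfl⟩
  rcases hmem with ⟨j, hj, hjk⟩ | ⟨j, hj, hjk⟩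
  · exact Or.inl (by rw [hjk, eq_of_alignVec_eq hj hk hjk])
  · exact Or.inr (by rw [hjk, eq_of_alignVec_eq hj hk hjk])

theorem perm_eq_of_semiAlignSet_eq {n : ℕ} {σ τ : Equiv.Perm (Fin n)}
    (h : semiAlignSet τ = semiAlignSet σ) (h₁ : alignVec τ 1 = alignVec σ 1) : τ = σ := by
  refine perm_eq_of_alignVec_eq fun k hk => ?_
  rcases alignVec_mem_semiAlignSet hk h with hσ | hrev
  · exact hσ
  rw [alignVec_eq_iff] at h₁ hrev ⊢
  rcases Nat.eq_zero_or_pos k with rfl | hpos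
  · simp
  have hn : 0 < n := by omega
  have hfirst := h₁ (σ ⟨0, hn⟩)
  have hlast := hrev (σ ⟨0, hn⟩)
  simp [Equiv.Perm.mul_def, Fin.val_rev] at hfirst hlast
  intro i
  have hτ := (τ.symm i).isLt
  have hσ := (σ.symm i).isLt
  have hzero : (τ.symm (σ ⟨0, hn⟩) : ℕ) = 0 := by simp [hfirst]
  omega

/-- For `n ≥ 2`: an alignment differs from its opposite, and exactly the two
alignments `A_σ`, `A_{σ∘rev}` give rise to the semi-alignment `S_σ`. -/
theorem semiAlignSet_degree_two {n : ℕ} (hn : 2 ≤ n) (σ : Equiv.Perm (Fin n)) :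
    alignSet σ ≠ alignSet (σ * Fin.revPerm) ∧
    (∀ τ : Equiv.Perm (Fin n),
      semiAlignSet τ = semiAlignSet σ ↔ τ = σ ∨ τ = σ * Fin.revPerm) := by
  refine ⟨fun h => ?_, fun τ => ⟨fun h => ?_, ?_⟩⟩
  · have hrev := Equiv.congr_fun (alignSet_injective h) ⟨0, by omega⟩
    simp only [Equiv.Perm.mul_apply, Fin.revPerm_apply, EmbeddingLike.apply_eq_iff_eq,
      Fin.ext_iff, Fin.val_rev] at hrev
    omega
  · rcases alignVec_mem_semiAlignSet (by omega : 1 ≤ n) h with h₁ | h₁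
    · exact Or.inl (perm_eq_of_semiAlignSet_eq h h₁)
    · exact Or.inr (perm_eq_of_semiAlignSet_eq (h.trans (semiAlignSet_mul_revPerm σ).symm) h₁)
  · rintro (rfl | rfl)
    · rfl
    · exact semiAlignSet_mul_revPerm σ
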